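/- arXiv:2603.28302 — 3 statements merged into one kernel-verified Lean document; each statement's English description precedes it below -/
import Mathlib

section
/- Let l ≥ 1 and let k₁ < k₂ < … < k_l be positive integers with m = Σ_{j=1}^l k_j, let β be a real number with β > m, and let φ₁,…,φ_l be complex numbers. For each sign vector δ ∈ {−1,+1}^l define s_δ = Σ_{j=1}^l δ_j k_j, V_δ = Π_{1 ≤ p < q ≤ l} (δ_q k_q − δ_p k_p), C_δ = (2i)^l · i^{l(l−1)/2} · ( Π_{j=1}^l δ_j e^{i δ_j φ_j} ) · V_δ, and D_δ = (−i)^{−l} · C_δ · Π_{j=1}^l (β + δ_j k_j). Suppose there exists C₂ ∈ ℂ such that Σ_{δ ∈ {−1,+1}^l} D_δ e^{i s_δ ζ} = C₂ · Σ_{δ ∈ {−1,+1}^l} conj(C_{−δ}) e^{i s_δ ζ} for all ζ ∈ ℂ. Then Im φ_j = (1/4) log( (β + k_j)/(β − k_j) ) for every 1 ≤ j ≤ l. -/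
open Finset

/-- The sign `±1` associated with a Boolean. -/
noncomputable def sgn (b : Bool) : ℝ := if b then 1 else -1

/-- `s_δ = Σ_j δ_j k_j`. -/
noncomputable def sVal {l : ℕ} (k : Fin l → ℕ) (δ : Fin l → Bool) : ℝ :=
  ∑ j, sgn (δ j) * (k j : ℝ)

/-- `V_δ = Π_{p<q} (δ_q k_q - δ_p k_p)`. -/
noncomputable def VVal {l : ℕ} (k : Fin l → ℕ) (δ : Fin l → Bool) : ℝ :=
  ∏ q : Fin l, ∏ p ∈ Finset.univ.filter (fun p => p < q),
    (sgn (δ q) * (k q : ℝ) - sgn (δ p) * (k p : ℝ))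

/-- `C_δ = (2i)^l i^{l(l-1)/2} (Π_j δ_j e^{i δ_j φ_j}) V_δ`. -/
noncomputable def CVal {l : ℕ} (k : Fin l → ℕ) (φ : Fin l → ℂ) (δ : Fin l → Bool) : ℂ :=
  (2 * Complex.I) ^ l * Complex.I ^ (l * (l - 1) / 2) *
    (∏ j, ((sgn (δ j) : ℝ) : ℂ) * Complex.exp (Complex.I * ((sgn (δ j) : ℝ) : ℂ) * φ j)) *
    ((VVal k δ : ℝ) : ℂ)

/-- `D_δ = (-i)^{-l} C_δ Π_j (β + δ_j k_j)`. -/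
noncomputable def DVal {l : ℕ} (k : Fin l → ℕ) (β : ℝ) (φ : Fin l → ℂ) (δ : Fin l → Bool) : ℂ :=
  (-Complex.I) ^ (-(l : ℤ)) * CVal k φ δ *
    ∏ j, ((β : ℂ) + ((sgn (δ j) : ℝ) : ℂ) * ((k j : ℕ) : ℂ))

theorem sgn_not (b : Bool) : sgn (!b) = -sgn b := by
  cases b <;> simp [sgn]

theorem sgn_ne_zero (b : Bool) : sgn b ≠ 0 := by
  cases b <;> simp [sgn]

/-- The number of pairs `p < q` in `Fin l`. -/
theorem sum_card_filter_lt (l : ℕ) :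
    ∑ q : Fin l, (univ.filter (fun p : Fin l => p < q)).card = l * (l - 1) / 2 := by
  simp only [Finset.filter_gt_eq_Iio, Fin.card_Iio]
  rw [← Finset.sum_range_id, ← Fin.sum_univ_eq_sum_range (fun i => i)]

theorem VVal_not {l : ℕ} (k : Fin l → ℕ) (δ : Fin l → Bool) :
    VVal k (fun j => !(δ j)) = (-1) ^ (l * (l - 1) / 2) * VVal k δ := by
  rw [← sum_card_filter_lt, ← Finset.prod_pow_eq_pow_sum]
  unfold VVal
  rw [← Finset.prod_mul_distrib]
  refine Finset.prod_congr rfl fun q _ => ?_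
  rw [← Finset.prod_const, ← Finset.prod_mul_distrib]
  refine Finset.prod_congr rfl fun p _ => ?_
  rw [sgn_not, sgn_not]
  ring

theorem VVal_ne_zero {l : ℕ} {k : Fin l → ℕ} (hkpos : ∀ j, 0 < k j) (hkmono : StrictMono k)
    (δ : Fin l → Bool) : VVal k δ ≠ 0 := by
  unfold VVal
  refine Finset.prod_ne_zero_iff.mpr fun q _ => Finset.prod_ne_zero_iff.mpr fun p hp => ?_
  have hlt : (k p : ℝ) < k q := by
    exact_mod_cast hkmono (Finset.mem_filter.mp hp).2
  have hp0 : (0 : ℝ) < k p := by exact_mod_cast hkpos p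
  cases δ q <;> cases δ p <;> simp only [sgn] <;> intro h <;> simp at h <;> linarith

theorem CVal_ne_zero {l : ℕ} {k : Fin l → ℕ} (hkpos : ∀ j, 0 < k j) (hkmono : StrictMono k)
    (φ : Fin l → ℂ) (δ : Fin l → Bool) : CVal k φ δ ≠ 0 := by
  unfold CVal
  refine mul_ne_zero (mul_ne_zero (mul_ne_zero ?_ ?_) ?_) ?_
  · exact pow_ne_zero _ (mul_ne_zero two_ne_zero Complex.I_ne_zero)
  · exact pow_ne_zero _ Complex.I_ne_zero
  · exact Finset.prod_ne_zero_iff.mpr fun j _ =>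
      mul_ne_zero (Complex.ofReal_ne_zero.mpr (sgn_ne_zero _)) (Complex.exp_ne_zero _)
  · exact Complex.ofReal_ne_zero.mpr (VVal_ne_zero hkpos hkmono δ)

theorem CVal_eq_conj_mul {l : ℕ} (k : Fin l → ℕ) (φ : Fin l → ℂ) (δ : Fin l → Bool) :
    CVal k φ δ = (starRingEnd ℂ) (CVal k φ (fun j => !(δ j))) *
      ∏ j, ((Real.exp (-2 * sgn (δ j) * (φ j).im) : ℝ) : ℂ) := by
  have key : ∀ j, ((sgn (δ j) : ℝ) : ℂ) * Complex.exp (Complex.I * ((sgn (δ j) : ℝ) : ℂ) * φ j) =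
      (-1) * (starRingEnd ℂ) (((sgn (!(δ j)) : ℝ) : ℂ) *
        Complex.exp (Complex.I * ((sgn (!(δ j)) : ℝ) : ℂ) * φ j)) *
        ((Real.exp (-2 * sgn (δ j) * (φ j).im) : ℝ) : ℂ) := by
    intro j
    rw [sgn_not, map_mul, ← Complex.exp_conj, Complex.conj_ofReal, Complex.ofReal_exp]
    simp only [map_mul, Complex.conj_I, Complex.conj_ofReal]
    have : Complex.I * ((sgn (δ j) : ℝ) : ℂ) * φ j =
        -Complex.I * ((-sgn (δ j) : ℝ) : ℂ) * (starRingEnd ℂ) (φ j) +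
          ((-2 * sgn (δ j) * (φ j).im : ℝ) : ℂ) := by
      apply Complex.ext <;> simp
      ring
    rw [this, Complex.exp_add]
    push_cast
    ring
  unfold CVal
  rw [Finset.prod_congr rfl fun j _ => key j, VVal_not]
  simp only [Finset.prod_mul_distrib, map_mul, map_pow, Complex.conj_I, Complex.conj_ofReal,
    map_prod, Finset.prod_const, Finset.card_univ, Fintype.card_fin, map_ofNat, mul_pow]
  push_cast
  rw [neg_pow Complex.I l, neg_pow Complex.I (l * (l - 1) / 2)]
  have h : ((-1 : ℂ) ^ (l * (l - 1) / 2)) * (-1) ^ (l * (l - 1) / 2) = 1 := by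
    rw [← mul_pow]; simp
  linear_combination (-(2 ^ l * Complex.I ^ l * Complex.I ^ (l * (l - 1) / 2) * (-1) ^ l *
    (∏ j, ((sgn (!(δ j)) : ℝ) : ℂ)) * (∏ j, (starRingEnd ℂ)
      (Complex.exp (Complex.I * ((sgn (!(δ j)) : ℝ) : ℂ) * φ j))) *
    (∏ j, Complex.exp (-2 * ((sgn (δ j) : ℝ) : ℂ) * ((φ j).im : ℂ))) * ((VVal k δ : ℝ) : ℂ))) * h

/-- The real factor by which the `j`-th sign contributes to `D_δ / conj C_{-δ}`. -/
noncomputable def ratioFactor {l : ℕ} (k : Fin l → ℕ) (β : ℝ) (φ : Fin l → ℂ) (j : Fin l)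
    (b : Bool) : ℝ :=
  Real.exp (-2 * sgn b * (φ j).im) * (β + sgn b * k j)

theorem DVal_eq {l : ℕ} (k : Fin l → ℕ) (β : ℝ) (φ : Fin l → ℂ) (δ : Fin l → Bool) :
    DVal k β φ δ = (-Complex.I) ^ (-(l : ℤ)) * ((∏ j, ratioFactor k β φ j (δ j) : ℝ) : ℂ) *
      (starRingEnd ℂ) (CVal k φ (fun j => !(δ j))) := by
  unfold DVal ratioFactor
  rw [CVal_eq_conj_mul, Finset.prod_mul_distrib]
  push_cast
  ring

/-- The sum of the `k j` over the negative signs of `δ`. -/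
def negSum {l : ℕ} (k : Fin l → ℕ) (δ : Fin l → Bool) : ℕ :=
  ∑ j, if δ j then 0 else k j

theorem sVal_eq {l : ℕ} (k : Fin l → ℕ) (δ : Fin l → Bool) :
    sVal k δ = (∑ j, (k j : ℝ)) - 2 * (negSum k δ : ℝ) := by
  unfold sVal negSum
  push_cast
  rw [Finset.mul_sum, ← Finset.sum_sub_distrib]
  refine Finset.sum_congr rfl fun j _ => ?_
  cases δ j <;> simp [sgn]
  ring

/-- Coefficient comparison in a vanishing exponential sum, grouped by equal frequencies. -/
theorem sum_filter_negSum_eq_zero {l : ℕ} (k : Fin l → ℕ) (G : (Fin l → Bool) → ℂ)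
    (h : ∀ ζ : ℂ, ∑ δ, G δ * Complex.exp (Complex.I * ((sVal k δ : ℝ) : ℂ) * ζ) = 0) (n : ℕ) :
    ∑ δ ∈ univ.filter (fun δ => negSum k δ = n), G δ = 0 := by
  let P : Polynomial ℂ := ∑ δ, Polynomial.monomial (negSum k δ) (G δ)
  have hroot : ∀ w : ℂ, w ≠ 0 → P.eval w = 0 := by
    intro w hw
    have h1 := h (Complex.I / 2 * Complex.log w)
    have hterm : ∀ δ, G δ * Complex.exp (Complex.I * ((sVal k δ : ℝ) : ℂ) *
        (Complex.I / 2 * Complex.log w)) =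
        Complex.exp (-((∑ j, (k j : ℝ) : ℝ) : ℂ) / 2 * Complex.log w) *
          (G δ * w ^ negSum k δ) := by
      intro δ
      have hpow : w ^ negSum k δ = Complex.exp (negSum k δ * Complex.log w) := by
        rw [Complex.exp_nat_mul, Complex.exp_log hw]
      rw [hpow, mul_left_comm (Complex.exp _), ← Complex.exp_add, sVal_eq]
      congr 2
      push_cast
      linear_combination ((∑ j, (k j : ℂ)) - 2 * (negSum k δ : ℂ)) / 2 * Complex.log w *
        Complex.I_mul_I
    rw [Finset.sum_congr rfl fun δ _ => hterm δ, ← Finset.mul_sum] at h1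
    simpa [P, Polynomial.eval_finsetSum] using h1
  have hP : P = 0 := by
    refine Polynomial.eq_zero_of_infinite_isRoot P ?_
    exact (Set.finite_singleton (0 : ℂ)).infinite_compl.mono fun w hw => hroot w hw
  have hc := congrArg (fun p => Polynomial.coeff p n) hP
  simpa [P, Polynomial.finsetSum_coeff, Polynomial.coeff_monomial, Finset.sum_filter] using hc

theorem le_negSum {l : ℕ} (k : Fin l → ℕ) {δ : Fin l → Bool} {i : Fin l} (hi : δ i = false) :
    k i ≤ negSum k δ := by
  have := Finset.single_le_sum (f := fun j => if δ j then 0 else k j)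
    (fun _ _ => Nat.zero_le _) (Finset.mem_univ i)
  simpa [hi, negSum] using this

theorem negSum_eq_zero_iff {l : ℕ} {k : Fin l → ℕ} (hkpos : ∀ j, 0 < k j) (δ : Fin l → Bool) :
    negSum k δ = 0 ↔ δ = fun _ => true := by
  constructor
  · intro h
    funext i
    by_contra hi
    have := le_negSum k (Bool.eq_false_iff.mpr hi)
    have := hkpos i
    omega
  · rintro rfl
    simp [negSum]

theorem negSum_update {l : ℕ} (k : Fin l → ℕ) (j : Fin l) :
    negSum k (Function.update (fun _ => true) j false) = k j := by
  unfold negSum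
  rw [Finset.sum_eq_single j]
  · simp
  · intro i _ hi
    simp [hi]
  · simp

theorem eq_update_of_negSum_eq {l : ℕ} {k : Fin l → ℕ} (hkpos : ∀ j, 0 < k j)
    {δ : Fin l → Bool} {j : Fin l} (h : negSum k δ = k j) (hj : δ j = false) :
    δ = Function.update (fun _ => true) j false := by
  funext i
  rcases eq_or_ne i j with rfl | hij
  · simp [hj]
  · rw [Function.update_of_ne hij]
    by_contra hi
    have hi' := Bool.eq_false_iff.mpr hi
    have h2 := Finset.add_le_sum (f := fun j => if δ j then 0 else k j)
      (fun _ _ => Nat.zero_le _) (Finset.mem_univ i) (Finset.mem_univ j) hij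
    have h3 : (∑ j, if δ j then 0 else k j) = k j := h
    simp only [h3, hi', hj, Bool.false_eq_true, if_false] at h2
    have := hkpos i
    omega

theorem stmt7 (l : ℕ) (hl : 1 ≤ l) (k : Fin l → ℕ) (hkpos : ∀ j, 0 < k j)
    (hkmono : StrictMono k) (β : ℝ) (hβ : (∑ j, (k j : ℝ)) < β) (φ : Fin l → ℂ)
    (hid : ∃ C₂ : ℂ, ∀ ζ : ℂ,
      ∑ δ : Fin l → Bool, DVal k β φ δ * Complex.exp (Complex.I * ((sVal k δ : ℝ) : ℂ) * ζ)
        = C₂ * ∑ δ : Fin l → Bool,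
            (starRingEnd ℂ) (CVal k φ (fun j => !(δ j))) *
              Complex.exp (Complex.I * ((sVal k δ : ℝ) : ℂ) * ζ)) :
    ∀ j, (φ j).im = (1 / 4) * Real.log ((β + (k j : ℝ)) / (β - (k j : ℝ))) := by
  obtain ⟨C₂, hid⟩ := hid
  set c : ℂ := (-Complex.I) ^ (-(l : ℤ))
  have hc : c ≠ 0 := zpow_ne_zero _ (neg_ne_zero.mpr Complex.I_ne_zero)
  let E : (Fin l → Bool) → ℂ := fun δ => (starRingEnd ℂ) (CVal k φ (fun j => !(δ j)))
  have hE : ∀ δ, E δ ≠ 0 := fun δ =>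
    (map_ne_zero (starRingEnd ℂ)).mpr (CVal_ne_zero hkpos hkmono φ _)
  let R : (Fin l → Bool) → ℝ := fun δ => ∏ j, ratioFactor k β φ j (δ j)
  have hcoeff := sum_filter_negSum_eq_zero k (fun δ => (c * (R δ : ℂ) - C₂) * E δ) (by
    intro ζ
    have h := hid ζ
    rw [Finset.mul_sum, ← sub_eq_zero, ← Finset.sum_sub_distrib] at h
    rw [← h]
    refine Finset.sum_congr rfl fun δ _ => ?_
    rw [DVal_eq]
    ring)
  have hC₂ : C₂ = c * (R fun _ => true : ℂ) := by
    have h := hcoeff 0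
    simp only [negSum_eq_zero_iff hkpos, Finset.filter_eq', Finset.mem_univ, if_true,
      Finset.sum_singleton] at h
    exact (sub_eq_zero.mp ((mul_eq_zero.mp h).resolve_right (hE _))).symm
  have hk_lt : ∀ j, (k j : ℝ) < β := fun j =>
    (Finset.single_le_sum (f := fun j => (k j : ℝ)) (fun _ _ => Nat.cast_nonneg _)
      (Finset.mem_univ j)).trans_lt hβ
  have hpos : ∀ j b, 0 < ratioFactor k β φ j b := by
    intro j b
    have h1 := hk_lt j
    have h2 : (0 : ℝ) < k j := by exact_mod_cast hkpos j
    refine mul_pos (Real.exp_pos _) ?_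
    cases b <;> simp only [sgn, Bool.false_eq_true, if_true, if_false] <;> linarith
  have hfactor : ∀ j, ratioFactor k β φ j false = ratioFactor k β φ j true := by
    intro j
    induction j using WellFoundedLT.induction with
    | ind j ih =>
      have h := hcoeff (k j)
      rw [Finset.sum_eq_single (Function.update (fun _ => true) j false)] at h
      · have h1 := sub_eq_zero.mp ((mul_eq_zero.mp h).resolve_right (hE _))
        rw [hC₂] at h1
        have h2 : R (Function.update (fun _ => true) j false) = R fun _ => true := by
          exact_mod_cast mul_left_cancel₀ hc h1
        simp only [R] at h2
        rw [← Finset.mul_prod_erase _ _ (Finset.mem_univ j),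
          ← Finset.mul_prod_erase _ (fun i => ratioFactor k β φ i true) (Finset.mem_univ j),
          Function.update_self] at h2
        have h3 : ∏ i ∈ univ.erase j, ratioFactor k β φ i
            (Function.update (fun _ => true) j false i) =
            ∏ i ∈ univ.erase j, ratioFactor k β φ i true :=
          Finset.prod_congr rfl fun i hi => by
            rw [Function.update_of_ne (Finset.ne_of_mem_erase hi)]
        rw [h3] at h2
        exact mul_right_cancel₀ (Finset.prod_pos fun i _ => hpos i true).ne' h2
      · intro δ hδ hne
        have hδ' : negSum k δ = k j := (Finset.mem_filter.mp hδ).2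
        have hR : R δ = R fun _ => true := by
          refine Finset.prod_congr rfl fun i _ => ?_
          cases hi : δ i with
          | true => rfl
          | false =>
            refine ih i (lt_of_le_of_ne (hkmono.le_iff_le.mp (hδ' ▸ le_negSum k hi)) ?_)
            rintro rfl
            exact hne (eq_update_of_negSum_eq hkpos hδ' hi)
        rw [hR, hC₂, sub_self, zero_mul]
      · intro hn
        exact absurd (by simpa using negSum_update k j) hn
  intro j
  have h := congrArg Real.log (hfactor j)
  have h1 := hk_lt j
  have h2 : (0 : ℝ) < k j := by exact_mod_cast hkpos j
  have hm : 0 < β - k j := by linarith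
  have hp : 0 < β + k j := by linarith
  simp only [ratioFactor, sgn, Bool.false_eq_true, if_true, if_false, neg_mul, one_mul,
    mul_neg, mul_one, neg_neg, ← sub_eq_add_neg] at h
  rw [Real.log_mul (Real.exp_ne_zero _) hm.ne', Real.log_mul (Real.exp_ne_zero _) hp.ne',
    Real.log_exp, Real.log_exp] at h
  rw [Real.log_div hp.ne' hm.ne']
  linarith
end

section
/- Let p ≥ 1 and let w₁,…,w_p be complex numbers such that the 2p numbers w₁,…,w_p, −conj(w₁),…,−conj(w_p) are pairwise distinct, and suppose that Σ_{k≠j} 1/(w_j − w_k) − Σ_{k=1}^p 1/(w_j + conj(w_k)) − 1/2 = 0 for every 1 ≤ j ≤ p. Define the polynomials 𝒫(z) = Π_{j=1}^p (z − w_j) and 𝒬(z) = Π_{j=1}^p (z + conj(w_j)). Then (𝒫''(z) − 𝒫'(z))·𝒬(z) + (𝒬''(z) + 𝒬'(z))·𝒫(z) − 2 𝒫'(z) 𝒬'(z) = 0 for all z ∈ ℂ. -/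
open Finset Polynomial

theorem eval_derivative_prod_X_sub_C {ι K : Type*} [Field K] (s : Finset ι) (a : ι → K) (z : K)
    (h : ∀ k ∈ s, z ≠ a k) :
    (derivative (∏ k ∈ s, (X - C (a k)))).eval z
      = (∏ k ∈ s, (X - C (a k))).eval z * ∑ k ∈ s, 1 / (z - a k) := by
  classical
  induction s using Finset.induction_on with
  | empty => simp
  | insert i s hi ih =>
    have hz : z - a i ≠ 0 := sub_ne_zero.2 (h i (Finset.mem_insert_self i s))
    have ih' := ih fun k hk => h k (Finset.mem_insert_of_mem hk)
    rw [Finset.prod_insert hi, Finset.sum_insert hi, derivative_mul]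
    simp only [eval_add, eval_mul, ih', derivative_X_sub_C, eval_one, eval_sub, eval_X, eval_C]
    field_simp

/-- The second derivative of a polynomial with simple roots, evaluated at one of its roots. -/
theorem eval_derivative_derivative_prod_X_sub_C {ι K : Type*} [Fintype ι] [DecidableEq ι] [Field K]
    (a : ι → K) (ha : Function.Injective a) (j : ι) :
    (derivative (derivative (∏ k, (X - C (a k))))).eval (a j)
      = 2 * (derivative (∏ k, (X - C (a k)))).eval (a j)
        * ∑ k ∈ Finset.univ.erase j, 1 / (a j - a k) := by
  have h := eval_derivative_prod_X_sub_C (Finset.univ.erase j) a (a j)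
    fun k hk e => Finset.ne_of_mem_erase hk (ha e).symm
  rw [← Finset.mul_prod_erase Finset.univ _ (Finset.mem_univ j)]
  simp only [derivative_mul, derivative_add, derivative_X_sub_C, derivative_one, eval_add, eval_mul,
    eval_sub, eval_X, eval_C, eval_one, eval_zero, h, zero_mul, sub_self]
  ring

theorem natDegree_bilinear_lt {R : Type*} [CommRing R] {n : ℕ} (hn : 1 ≤ n) {P Q : R[X]}
    (hP : P.natDegree ≤ n) (hQ : Q.natDegree ≤ n) :
    ((derivative (derivative P) - derivative P) * Q
      + (derivative (derivative Q) + derivative Q) * P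
      - 2 * derivative P * derivative Q).natDegree < n + n := by
  have hP1 : (derivative P).natDegree ≤ n - 1 :=
    (natDegree_derivative_le P).trans (Nat.sub_le_sub_right hP 1)
  have hQ1 : (derivative Q).natDegree ≤ n - 1 :=
    (natDegree_derivative_le Q).trans (Nat.sub_le_sub_right hQ 1)
  have hP2 : (derivative (derivative P)).natDegree ≤ n - 1 :=
    (natDegree_derivative_le _).trans ((Nat.sub_le _ _).trans hP1)
  have hQ2 : (derivative (derivative Q)).natDegree ≤ n - 1 :=
    (natDegree_derivative_le _).trans ((Nat.sub_le _ _).trans hQ1)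
  have h1 := natDegree_mul_le_of_le (natDegree_sub_le_of_le hP2 hP1) hQ
  have h2 := natDegree_mul_le_of_le (natDegree_add_le_of_le hQ2 hQ1) hP
  have h3 := natDegree_mul_le_of_le
    (natDegree_mul_le_of_le (natDegree_ofNat (R := R) 2).le hP1) hQ1
  have h4 := natDegree_sub_le_of_le (natDegree_add_le_of_le h1 h2) h3
  simp only [max_self] at h4
  refine h4.trans_lt ?_
  rw [max_lt_iff]
  omega

theorem stmt8 (p : ℕ) (hp : 1 ≤ p) (w : Fin p → ℂ)
    (hdist : Function.Injective
      (Sum.elim w (fun j => -(starRingEnd ℂ) (w j)) : Fin p ⊕ Fin p → ℂ))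
    (hsys : ∀ j, ∑ k ∈ Finset.univ.erase j, 1 / (w j - w k)
        - ∑ k, 1 / (w j + (starRingEnd ℂ) (w k)) - 1 / 2 = 0)
    (P Q : ℂ[X])
    (hP : P = ∏ j, (X - C (w j)))
    (hQ : Q = ∏ j, (X + C ((starRingEnd ℂ) (w j)))) :
    ∀ z : ℂ,
      (P.derivative.derivative.eval z - P.derivative.eval z) * Q.eval z
      + (Q.derivative.derivative.eval z + Q.derivative.eval z) * P.eval z
      - 2 * P.derivative.eval z * Q.derivative.eval z = 0 := by
  set v : Fin p → ℂ := fun j => -(starRingEnd ℂ) (w j) with hv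
  have hQ' : Q = ∏ j, (X - C (v j)) := by simp [hQ, hv]
  have hw_inj : Function.Injective w := hdist.comp Sum.inl_injective
  have hv_inj : Function.Injective v := hdist.comp Sum.inr_injective
  have hwv : ∀ j k, w j ≠ v k := fun j k e => Sum.inl_ne_inr (hdist (a₁ := .inl j) (a₂ := .inr k) e)
  have hPdeg : P.natDegree ≤ p := by simp [hP]
  have hQdeg : Q.natDegree ≤ p := by simp [hQ']
  have hPw : ∀ j, P.eval (w j) = 0 := fun j => by
    rw [hP, eval_prod]; exact Finset.prod_eq_zero (Finset.mem_univ j) (by simp)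
  have hQv : ∀ j, Q.eval (v j) = 0 := fun j => by
    rw [hQ', eval_prod]; exact Finset.prod_eq_zero (Finset.mem_univ j) (by simp)
  have hsys_v : ∀ j, ∑ k ∈ Finset.univ.erase j, 1 / (v j - v k)
      - ∑ k, 1 / (v j - w k) + 1 / 2 = 0 := by
    intro j
    have h := congrArg (starRingEnd ℂ) (hsys j)
    simp only [map_sub, map_sum, map_div₀, map_one, map_add, Complex.conj_conj, map_zero,
      map_ofNat] at h
    have e1 : ∀ k, 1 / (v j - v k) = -(1 / ((starRingEnd ℂ) (w j) - (starRingEnd ℂ) (w k))) := by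
      intro k; rw [← one_div_neg_eq_neg_one_div]; congr 1; simp only [hv]; ring
    have e2 : ∀ k, 1 / (v j - w k) = -(1 / ((starRingEnd ℂ) (w j) + w k)) := by
      intro k; rw [← one_div_neg_eq_neg_one_div]; congr 1; simp only [hv]; ring
    simp only [e1, e2, Finset.sum_neg_distrib]
    linear_combination -h
  have hdeg := (natDegree_bilinear_lt hp hPdeg hQdeg).trans_eq
    (show p + p = Fintype.card (Fin p ⊕ Fin p) by simp)
  have hF := eq_zero_of_natDegree_lt_card_of_eval_eq_zero _ hdist ?_ hdeg
  · intro z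
    simpa using congrArg (eval z) hF
  rintro (j | j)
  · have h1 := eval_derivative_derivative_prod_X_sub_C w hw_inj j
    have h2 := eval_derivative_prod_X_sub_C Finset.univ v (w j) fun k _ => hwv j k
    rw [← hP] at h1
    rw [← hQ'] at h2
    have h3 := hsys j
    simp only [hv, sub_neg_eq_add] at h2
    simp only [Sum.elim_inl, eval_add, eval_sub, eval_mul, eval_ofNat, hPw, h1, h2]
    linear_combination 2 * eval (w j) (derivative P) * eval (w j) Q * h3
  · have h1 := eval_derivative_derivative_prod_X_sub_C v hv_inj j
    have h2 := eval_derivative_prod_X_sub_C Finset.univ w (v j) fun k _ => (hwv k j).symm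
    rw [← hQ'] at h1
    rw [← hP] at h2
    simp only [Sum.elim_inr, eval_add, eval_sub, eval_mul, eval_ofNat, hQv, h1, h2]
    linear_combination 2 * eval (v j) (derivative Q) * eval (v j) P * hsys_v j
end

section
/- Let m ≥ 2 and define E₀(φ₁,…,φ_m) = Σ_{1 ≤ j < k ≤ m} 1/sin²((φ_j − φ_k)/2) on the open set X = { (φ₁,…,φ_m) ∈ ℝ^m : φ₁ < φ₂ < … < φ_m < φ₁ + 2π and Σ_{j=1}^m φ_j = 0 }. Then for every φ ∈ X and every v ∈ ℝ^m with Σ_{j=1}^m v_j = 0, the second derivative of E₀ at φ in direction v satisfies D²E₀(φ)[v,v] ≥ (m/2)·Σ_{j=1}^m v_j². -/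
open Finset

/-- `E₀(φ) = Σ_{j<k} 1/sin²((φ_j - φ_k)/2)`. -/
noncomputable def E0 (m : ℕ) (φ : Fin m → ℝ) : ℝ :=
  ∑ j, ∑ k, (if j < k then 1 / Real.sin ((φ j - φ k) / 2) ^ 2 else 0)

/-- First derivative of `1 / sin² (x / 2)`. -/
theorem hasDerivAt_one_div_sin_half_sq {x : ℝ} (h : Real.sin (x / 2) ≠ 0) :
    HasDerivAt (fun x : ℝ => 1 / Real.sin (x / 2) ^ 2)
      (-(Real.cos (x / 2) / Real.sin (x / 2) ^ 3)) x := by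
  have h1 : HasDerivAt (fun x : ℝ => Real.sin (x / 2)) (Real.cos (x / 2) * (1 / 2)) x :=
    ((hasDerivAt_id x).div_const 2).sin
  have h2 := (hasDerivAt_const x (1 : ℝ)).fun_div (h1.fun_pow 2) (pow_ne_zero 2 h)
  refine h2.congr_deriv ?_
  field_simp
  ring

/-- Second derivative of `1 / sin² (x / 2)`. -/
theorem hasDerivAt_neg_cos_half_div_sin_half_cube {x : ℝ} (h : Real.sin (x / 2) ≠ 0) :
    HasDerivAt (fun x : ℝ => -(Real.cos (x / 2) / Real.sin (x / 2) ^ 3))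
      ((Real.sin (x / 2) ^ 2 + 3 * Real.cos (x / 2) ^ 2) / (2 * Real.sin (x / 2) ^ 4)) x := by
  have h1 : HasDerivAt (fun x : ℝ => Real.sin (x / 2)) (Real.cos (x / 2) * (1 / 2)) x :=
    ((hasDerivAt_id x).div_const 2).sin
  have h2 : HasDerivAt (fun x : ℝ => Real.cos (x / 2)) (-Real.sin (x / 2) * (1 / 2)) x :=
    ((hasDerivAt_id x).div_const 2).cos
  have h3 := (h2.fun_div (h1.fun_pow 3) (pow_ne_zero 3 h)).fun_neg
  refine h3.congr_deriv ?_
  field_simp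
  ring

theorem half_le_sin_sq_add_cos_sq_div {x : ℝ} (h : Real.sin x ≠ 0) :
    1 / 2 ≤ (Real.sin x ^ 2 + 3 * Real.cos x ^ 2) / (2 * Real.sin x ^ 4) := by
  have hs : 0 < Real.sin x ^ 2 := by positivity
  rw [div_le_div_iff₀ (by norm_num) (by positivity)]
  nlinarith [Real.sin_sq_add_cos_sq x, mul_nonneg hs.le (sq_nonneg (Real.cos x)),
    sq_nonneg (Real.cos x)]

/-- A pair-interaction sum of a function `f` of the differences is differentiated termwise. -/
theorem hasFDerivAt_sum_pair {m : ℕ} {f : ℝ → ℝ} {f' : ℝ → ℝ} {φ : Fin m → ℝ}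
    (c : Fin m → Fin m → ℝ)
    (hf : ∀ j k, j < k → HasDerivAt f (f' (φ j - φ k)) (φ j - φ k)) :
    HasFDerivAt (fun ψ : Fin m → ℝ => ∑ j, ∑ k, (if j < k then f (ψ j - ψ k) * c j k else 0))
      (∑ j, ∑ k, (if j < k then (f' (φ j - φ k) * c j k) •
        (ContinuousLinearMap.proj (R := ℝ) (φ := fun _ : Fin m => ℝ) j -
          ContinuousLinearMap.proj (R := ℝ) (φ := fun _ : Fin m => ℝ) k) else 0)) φ := by
  refine HasFDerivAt.fun_sum fun j _ => HasFDerivAt.fun_sum fun k _ => ?_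
  split_ifs with hjk
  · have h1 : HasFDerivAt (fun ψ : Fin m → ℝ => ψ j - ψ k)
        (ContinuousLinearMap.proj (R := ℝ) (φ := fun _ : Fin m => ℝ) j -
          ContinuousLinearMap.proj (R := ℝ) (φ := fun _ : Fin m => ℝ) k) φ :=
      (hasFDerivAt_apply j φ).fun_sub (hasFDerivAt_apply k φ)
    exact ((hf j k hjk).mul_const (c j k)).comp_hasFDerivAt φ h1
  · exact hasFDerivAt_const _ _

theorem fderiv_sum_pair_apply {m : ℕ} {f : ℝ → ℝ} {f' : ℝ → ℝ} {φ : Fin m → ℝ}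
    (c : Fin m → Fin m → ℝ)
    (hf : ∀ j k, j < k → HasDerivAt f (f' (φ j - φ k)) (φ j - φ k)) (v : Fin m → ℝ) :
    fderiv ℝ (fun ψ : Fin m → ℝ =>
        ∑ j, ∑ k, (if j < k then f (ψ j - ψ k) * c j k else 0)) φ v =
      ∑ j, ∑ k, (if j < k then f' (φ j - φ k) * (c j k * (v j - v k)) else 0) := by
  rw [(hasFDerivAt_sum_pair c hf).fderiv]
  simp only [_root_.sum_apply]
  refine Finset.sum_congr rfl fun j _ => Finset.sum_congr rfl fun k _ => ?_
  split_ifs <;> simp [mul_assoc]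

theorem sum_pair_sq_sub {m : ℕ} (v : Fin m → ℝ) :
    ∑ j, ∑ k, (if j < k then (v j - v k) ^ 2 else 0) =
      m * ∑ j, v j ^ 2 - (∑ j, v j) ^ 2 := by
  have h1 : ∑ j, ∑ k, (v j - v k) ^ 2 = 2 * (m * ∑ j, v j ^ 2 - (∑ j, v j) ^ 2) := by
    simp only [sub_sq, Finset.sum_add_distrib, Finset.sum_sub_distrib, Finset.sum_const,
      Finset.card_univ, Fintype.card_fin, nsmul_eq_mul, ← Finset.mul_sum, ← Finset.sum_mul]
    ring
  have h2 : ∑ j, ∑ k, (v j - v k) ^ 2 =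
      ∑ j, ∑ k, (if j < k then (v j - v k) ^ 2 else 0) +
        ∑ j, ∑ k, (if k < j then (v k - v j) ^ 2 else 0) := by
    simp only [← Finset.sum_add_distrib]
    refine Finset.sum_congr rfl fun j _ => Finset.sum_congr rfl fun k _ => ?_
    rcases lt_trichotomy j k with h | rfl | h
    · simp [h, h.not_gt]
    · simp
    · simp only [h, h.not_gt, if_true, if_false]
      ring
  rw [Finset.sum_comm (f := fun j k => if k < j then (v k - v j) ^ 2 else 0)] at h2
  linarith

theorem stmt10 (m : ℕ) (hm : 2 ≤ m) (φ : Fin m → ℝ)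
    (hmono : StrictMono φ)
    (hspan : φ ⟨m - 1, by omega⟩ < φ ⟨0, by omega⟩ + 2 * Real.pi)
    (hsum : ∑ j, φ j = 0)
    (v : Fin m → ℝ) (hv : ∑ j, v j = 0) :
    (m : ℝ) / 2 * ∑ j, v j ^ 2 ≤ fderiv ℝ (fun ψ => fderiv ℝ (E0 m) ψ v) φ v := by
  have hne : ∀ j k : Fin m, j < k → Real.sin ((φ j - φ k) / 2) ≠ 0 := by
    intro j k hjk
    have h1 := hmono hjk
    have h2 : φ k ≤ φ ⟨m - 1, by omega⟩ := hmono.monotone (Fin.mk_le_mk.2 (by omega))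
    have h3 : φ ⟨0, by omega⟩ ≤ φ j := hmono.monotone (Fin.mk_le_mk.2 (by omega))
    exact (Real.sin_neg_of_neg_of_neg_pi_lt (by linarith) (by linarith)).ne
  have hE : E0 m = fun ψ => ∑ j, ∑ k,
      (if j < k then (fun x : ℝ => 1 / Real.sin (x / 2) ^ 2) (ψ j - ψ k) * 1 else 0) := by
    funext ψ
    simp [E0]
  have hev : ∀ᶠ ψ in nhds φ, ∀ j k : Fin m, j < k → Real.sin ((ψ j - ψ k) / 2) ≠ 0 := by
    simp only [Filter.eventually_all]
    intro j k hjk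
    have hc : Continuous fun ψ : Fin m → ℝ => Real.sin ((ψ j - ψ k) / 2) := by fun_prop
    exact hc.continuousAt.eventually_ne (hne j k hjk)
  have hgrad : (fun ψ => fderiv ℝ (E0 m) ψ v) =ᶠ[nhds φ] fun ψ => ∑ j, ∑ k,
      (if j < k then (fun x : ℝ => -(Real.cos (x / 2) / Real.sin (x / 2) ^ 3)) (ψ j - ψ k) *
        (1 * (v j - v k)) else 0) := by
    filter_upwards [hev] with ψ hψ
    rw [hE]
    exact fderiv_sum_pair_apply (φ := ψ) (fun _ _ => 1)
      (f := fun x : ℝ => 1 / Real.sin (x / 2) ^ 2)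
      (f' := fun x : ℝ => -(Real.cos (x / 2) / Real.sin (x / 2) ^ 3))
      (fun j k hjk => hasDerivAt_one_div_sin_half_sq (hψ j k hjk)) v
  have hhess := fderiv_sum_pair_apply (φ := φ) (fun j k => 1 * (v j - v k))
    (f := fun x : ℝ => -(Real.cos (x / 2) / Real.sin (x / 2) ^ 3))
    (f' := fun x => (Real.sin (x / 2) ^ 2 + 3 * Real.cos (x / 2) ^ 2) / (2 * Real.sin (x / 2) ^ 4))
    (fun j k hjk => hasDerivAt_neg_cos_half_div_sin_half_cube (hne j k hjk)) v
  rw [hgrad.fderiv_eq]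
  refine le_of_le_of_eq ?_ hhess.symm
  calc (m : ℝ) / 2 * ∑ j, v j ^ 2
      = 1 / 2 * ∑ j, ∑ k, (if j < k then (v j - v k) ^ 2 else 0) := by
        rw [sum_pair_sq_sub, hv]
        ring
    _ ≤ _ := by
        simp only [Finset.mul_sum]
        refine Finset.sum_le_sum fun j _ => Finset.sum_le_sum fun k _ => ?_
        split_ifs with hjk
        · rw [one_mul, ← sq]
          exact mul_le_mul_of_nonneg_right (half_le_sin_sq_add_cos_sq_div (hne j k hjk))
            (sq_nonneg _)
        · simp
end
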